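/- With C_v(ν, χ) the virtual mass coefficient as defined: for every ν ∈ (−1, 1/2), C_v(ν, 0) > 0 (the virtual mass coefficient is positive under no-slip conditions for all permissible Poisson ratios), and C_v(ν, 1) < −1/6 (under slip conditions the virtual mass coefficient is negative and less than its incompressible limiting value −1/6). -/

import Mathlib

/-- The virtual-mass coefficient `C_v(ν, χ)` of a spherical inclusion, Eq. (-432)
of the paper, with `κ⁻¹ = √((1−2ν)/(2(1−ν)))`. -/
noncomputable def Cv (ν χ : ℝ) : ℝ :=
  let κinv : ℝ := Real.sqrt ((1 - 2 * ν) / (2 * (1 - ν)))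
  9 * (2 + κinv ^ 3) ^ 2 / (2 + χ + κinv ^ 2) ^ 3
    - 6 * (2 - (5 / 4) * χ + κinv ^ 4) / (2 + χ + κinv ^ 2) ^ 2 - 1

/-- Sign properties of the virtual mass coefficient (Fig. 4 of the paper): for all
permissible Poisson ratios `ν ∈ (−1, 1/2)`, the no-slip coefficient is positive
and the slip coefficient is less than its incompressible limit `−1/6`. -/
theorem virtual_mass_sign (ν : ℝ) (hν : ν ∈ Set.Ioo (-1 : ℝ) (1 / 2)) :
    0 < Cv ν 0 ∧ Cv ν 1 < -(1 / 6) := by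
  obtain ⟨h1, h2⟩ := hν
  have hpos : 0 < (1 - 2 * ν) / (2 * (1 - ν)) := by
    apply div_pos <;> linarith
  have hlt : (1 - 2 * ν) / (2 * (1 - ν)) < 1 := by
    rw [div_lt_one (by linarith)]; linarith
  unfold Cv
  have hx0 := Real.sqrt_pos.mpr hpos
  have hx1 : Real.sqrt ((1 - 2 * ν) / (2 * (1 - ν))) < 1 := by
    rw [Real.sqrt_lt' one_pos]; simpa using hlt
  generalize Real.sqrt ((1 - 2 * ν) / (2 * (1 - ν))) = x at hx0 hx1
  constructor
  · have e : 9 * (2 + x ^ 3) ^ 2 / (2 + 0 + x ^ 2) ^ 3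
        - 6 * (2 - (5 / 4) * 0 + x ^ 4) / (2 + 0 + x ^ 2) ^ 2 - 1
        = (1 - x) ^ 2 * (2 * x ^ 4 + 4 * x ^ 3 + 4 * ((1 - x) * (1 + 3 * x)))
          / (2 + x ^ 2) ^ 3 := by
      have : (2 + x ^ 2) ≠ 0 := by positivity
      simp only [add_zero, mul_zero, sub_zero]
      field_simp
      ring
    have h : 0 < 1 - x := by linarith
    show 0 < 9 * (2 + x ^ 3) ^ 2 / (2 + 0 + x ^ 2) ^ 3
        - 6 * (2 - (5 / 4) * 0 + x ^ 4) / (2 + 0 + x ^ 2) ^ 2 - 1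
    rw [e]
    positivity
  · have e : 9 * (2 + x ^ 3) ^ 2 / (2 + 1 + x ^ 2) ^ 3
        - 6 * (2 - (5 / 4) * 1 + x ^ 4) / (2 + 1 + x ^ 2) ^ 2 - 1
        = -(1 / 6) - x ^ 2 * (27 - 36 * x + 51 / 2 * x ^ 2 - 13 / 6 * x ^ 4)
          / (3 + x ^ 2) ^ 3 := by
      have : (3 + x ^ 2) ≠ 0 := by positivity
      rw [show (2 + 1 + x ^ 2 : ℝ) = 3 + x ^ 2 by ring]
      field_simp
      ring
    have h4 : x ^ 4 < 1 := pow_lt_one₀ hx0.le hx1 (by norm_num)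
    have h : 0 < 27 - 36 * x + 51 / 2 * x ^ 2 - 13 / 6 * x ^ 4 := by
      nlinarith [sq_nonneg (x - 12 / 17)]
    show 9 * (2 + x ^ 3) ^ 2 / (2 + 1 + x ^ 2) ^ 3
        - 6 * (2 - (5 / 4) * 1 + x ^ 4) / (2 + 1 + x ^ 2) ^ 2 - 1 < -(1 / 6)
    rw [e]
    have : 0 < x ^ 2 * (27 - 36 * x + 51 / 2 * x ^ 2 - 13 / 6 * x ^ 4)
          / (3 + x ^ 2) ^ 3 := by positivity
    linarith
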